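/- arXiv:2203.11489 — 4 statements merged into one kernel-verified Lean document; each statement's English description precedes it below -/
import Mathlib

section
/- Fix an episodic MDP and a vector q̃ = (q̃_h)_{h=1}^H in ℝ^{S×A} with nonnegative entries satisfying ∑_{(s,a)} q̃_h(s,a) ≤ 1 for each h. Let ε_opt ≥ 0 and T ≥ 1. Suppose for t = 1,…,T: (i) w^(t) are the projected online gradient descent iterates on W with step size η = √(2|S||A|/T), initial point w^(1) = 0, and gradients g^(t) = (P^{π^(t)}_h(s,a) − q̃_h(s,a))_{h,s,a}; (ii) π^(t) is a policy satisfying ∑_{h=1}^H ∑_{(s,a)} w^(t)_h(s,a) P^{π^(t)}_h(s,a) ≥ sup_{π} ∑_{h=1}^H ∑_{(s,a)} w^(t)_h(s,a) P^{π}_h(s,a) − ε_opt, where the supremum is over all policies. If π̄ is a policy whose occupancy measure satisfies P^{π̄}_h = (1/T)∑_{t=1}^T P^{π^(t)}_h for every h, then ∑_{h=1}^H ‖P^{π̄}_h − q̃_h‖₁ ≤ inf_{π} ∑_{h=1}^H ‖P^{π}_h − q̃_h‖₁ + 2H√(2|S||A|/T) + ε_opt, where the infimum is over all policies. -/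
open Finset
open scoped Classical

/-- An episodic MDP: finite states `S`, finite actions `A`, horizon `H ≥ 1`,
initial distribution `ρ`, and (0-indexed) transition functions `P h (·|s,a)`. -/
structure MDP (S A : Type) [Fintype S] [Fintype A] where
  H : ℕ
  H_pos : 1 ≤ H
  ρ : S → ℝ
  ρ_nonneg : ∀ s, 0 ≤ ρ s
  ρ_sum_one : ∑ s, ρ s = 1
  P : ℕ → S → A → S → ℝ
  P_nonneg : ∀ h s a s', 0 ≤ P h s a s'
  P_sum_one : ∀ h s a, ∑ s', P h s a s' = 1

/-- A (time-dependent, 0-indexed) policy: `pr h s a` is the probability of action `a`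
in state `s` at step `h`. -/
structure Policy (S A : Type) [Fintype S] [Fintype A] where
  pr : ℕ → S → A → ℝ
  pr_nonneg : ∀ h s a, 0 ≤ pr h s a
  pr_sum_one : ∀ h s, ∑ a, pr h s a = 1

/-- Occupancy measure `P^π_h(s,a)` (0-indexed in `h`). -/
noncomputable def occ {S A : Type} [Fintype S] [Fintype A] (M : MDP S A) (π : Policy S A) :
    ℕ → S × A → ℝ
  | 0, sa => M.ρ sa.1 * π.pr 0 sa.1 sa.2
  | h + 1, sa => ∑ q : S × A, occ M π h q * M.P h q.1 q.2 sa.1 * π.pr (h + 1) sa.1 sa.2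

/-- `ℓ₁` norm on `ℝ^{S×A}`. -/
noncomputable def l1 {S A : Type} [Fintype S] [Fintype A] (v : S × A → ℝ) : ℝ :=
  ∑ sa : S × A, |v sa|

/-- Value of a policy w.r.t. a reward function. -/
noncomputable def value {S A : Type} [Fintype S] [Fintype A]
    (M : MDP S A) (π : Policy S A) (r : ℕ → S × A → ℝ) : ℝ :=
  ∑ h ∈ Finset.range M.H, ∑ sa : S × A, occ M π h sa * r h sa

/-- Probability of a truncated trajectory of length `n` under policy `π`. -/
noncomputable def trajProb {S A : Type} [Fintype S] [Fintype A]
    (M : MDP S A) (π : Policy S A) : (n : ℕ) → (Fin n → S × A) → ℝ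
  | 0, _ => 1
  | n + 1, tr =>
      M.ρ (tr 0).1 * π.pr 0 (tr 0).1 (tr 0).2 *
        ∏ ℓ : Fin n,
          (M.P (ℓ : ℕ) (tr ℓ.castSucc).1 (tr ℓ.castSucc).2 (tr ℓ.succ).1 *
            π.pr ((ℓ : ℕ) + 1) (tr ℓ.succ).1 (tr ℓ.succ).2)

/-- The state `s` appears at timestep `ℓ` (0-indexed) in some trajectory of `D₁`. -/
def appearsAt {S A : Type} [Fintype S] [Fintype A] {H : ℕ}
    (D₁ : Finset (Fin H → S × A)) (ℓ : ℕ) (s : S) : Prop :=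
  ∃ τ ∈ D₁, ∃ hℓ : ℓ < H, (τ ⟨ℓ, hℓ⟩).1 = s

/-- Membership in `Tr_h^{D₁}`: every state of the truncated trajectory appears in `D₁`
at the corresponding timestep. -/
def TrMem {S A : Type} [Fintype S] [Fintype A] {H : ℕ}
    (D₁ : Finset (Fin H → S × A)) {n : ℕ} (tr : Fin (n + 1) → S × A) : Prop :=
  ∀ ℓ : Fin (n + 1), appearsAt D₁ (ℓ : ℕ) (tr ℓ).1

/-- Membership in `Π_BC(D₁)`: the policy agrees with the expert `πE` on every state
visited in `D₁` at the corresponding timestep. -/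
def memPiBC {S A : Type} [Fintype S] [Fintype A]
    (M : MDP S A) (πE π : Policy S A) (D₁ : Finset (Fin M.H → S × A)) : Prop :=
  ∀ (ℓ : ℕ) (s : S), appearsAt D₁ ℓ s → ∀ a, π.pr ℓ s a = πE.pr ℓ s a

/-- Projected online gradient descent on `W = {w : |w_h(s,a)| ≤ 1}` with step size `η`
and gradient sequence `g`; 0-indexed, `ogd η g 0 = 0`. -/
noncomputable def ogd {S A : Type} [Fintype S] [Fintype A]
    (η : ℝ) (g : ℕ → ℕ → S × A → ℝ) : ℕ → ℕ → S × A → ℝ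
  | 0 => fun _ _ => 0
  | t + 1 => fun h sa => max (-1) (min 1 (ogd η g t h sa - η * g t h sa))

section OccupancyMeasure

variable {S A : Type} [Fintype S] [Fintype A]

theorem occ_nonneg (M : MDP S A) (π : Policy S A) (h : ℕ) (sa : S × A) :
    0 ≤ occ M π h sa := by
  induction h generalizing sa with
  | zero => exact mul_nonneg (M.ρ_nonneg _) (π.pr_nonneg _ _ _)
  | succ h ih =>
    exact Finset.sum_nonneg fun q _ =>
      mul_nonneg (mul_nonneg (ih q) (M.P_nonneg _ _ _ _)) (π.pr_nonneg _ _ _)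

theorem sum_occ (M : MDP S A) (π : Policy S A) (h : ℕ) :
    ∑ sa : S × A, occ M π h sa = 1 := by
  induction h with
  | zero => simp [occ, Fintype.sum_prod_type, ← Finset.mul_sum, π.pr_sum_one, M.ρ_sum_one]
  | succ h ih =>
    simp only [occ]
    rw [Finset.sum_comm, ← ih]
    refine Finset.sum_congr rfl fun q _ => ?_
    simp [Fintype.sum_prod_type, ← Finset.mul_sum, π.pr_sum_one, M.P_sum_one]

theorem sum_sq_occ_sub_le_two (M : MDP S A) (π : Policy S A) (h : ℕ) (q : S × A → ℝ)
    (hq_nonneg : ∀ sa, 0 ≤ q sa) (hq_sum : ∑ sa, q sa ≤ 1) :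
    ∑ sa, (occ M π h sa - q sa) ^ 2 ≤ 2 := by
  have hle : ∀ sa, (occ M π h sa - q sa) ^ 2 ≤ occ M π h sa + q sa := fun sa => by
    have hp1 : occ M π h sa ≤ 1 := (sum_occ M π h) ▸
      Finset.single_le_sum (fun i _ => occ_nonneg M π h i) (Finset.mem_univ sa)
    have hq1 : q sa ≤ 1 :=
      (Finset.single_le_sum (fun i _ => hq_nonneg i) (Finset.mem_univ sa)).trans hq_sum
    have hp0 := occ_nonneg M π h sa
    have hq0 := hq_nonneg sa
    nlinarith [mul_nonneg hp0 hq0]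
  have hsum := Finset.sum_le_sum fun sa (_ : sa ∈ Finset.univ) => hle sa
  rw [Finset.sum_add_distrib, sum_occ] at hsum
  linarith

end OccupancyMeasure

theorem sq_clip_sub_le {u : ℝ} (hu : |u| ≤ 1) (y : ℝ) :
    (max (-1) (min 1 y) - u) ^ 2 ≤ (y - u) ^ 2 := by
  obtain ⟨h1, h2⟩ := abs_le.mp hu
  rcases le_total 1 y with hy | hy
  · rw [min_eq_left hy, max_eq_right (by norm_num)]
    nlinarith
  · rw [min_eq_right hy]
    rcases le_total (-1) y with hy' | hy'
    · rw [max_eq_right hy']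
    · rw [max_eq_left hy']
      nlinarith

section OnlineGradientDescent

variable {S A : Type} [Fintype S] [Fintype A]

theorem abs_ogd_le_one (η : ℝ) (g : ℕ → ℕ → S × A → ℝ) (t h : ℕ) (sa : S × A) :
    |ogd η g t h sa| ≤ 1 := by
  cases t with
  | zero => simp [ogd]
  | succ t =>
    exact abs_le.mpr ⟨le_max_left _ _, max_le (by norm_num) (min_le_left _ _)⟩

/-- The regret bound of projected online gradient descent in a single coordinate. -/
theorem ogd_regret_le (η : ℝ) (g : ℕ → ℕ → S × A → ℝ) (h : ℕ) (sa : S × A)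
    {u : ℝ} (hu : |u| ≤ 1) (T : ℕ) :
    2 * η * ∑ t ∈ Finset.range T, g t h sa * (ogd η g t h sa - u)
      ≤ 1 + η ^ 2 * ∑ t ∈ Finset.range T, g t h sa ^ 2 := by
  have telescoped : 2 * η * ∑ t ∈ Finset.range T, g t h sa * (ogd η g t h sa - u)
      ≤ u ^ 2 - (ogd η g T h sa - u) ^ 2 + η ^ 2 * ∑ t ∈ Finset.range T, g t h sa ^ 2 := by
    induction T with
    | zero => simp [ogd]
    | succ T ih =>
      rw [Finset.sum_range_succ, Finset.sum_range_succ]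
      have hstep : (ogd η g (T + 1) h sa - u) ^ 2 ≤ (ogd η g T h sa - η * g T h sa - u) ^ 2 :=
        sq_clip_sub_le hu _
      linarith
  have hu2 : u ^ 2 ≤ 1 := (sq_le_one_iff_abs_le_one u).mpr hu
  linarith [sq_nonneg (ogd η g T h sa - u)]

end OnlineGradientDescent

section RewardValue

variable {S A : Type} [Fintype S] [Fintype A]

theorem bddAbove_range_sum_mul_occ (M : MDP S A) (r : ℕ → S × A → ℝ)
    (hr : ∀ h sa, |r h sa| ≤ 1) :
    BddAbove (Set.range fun π : Policy S A =>
      ∑ h ∈ Finset.range M.H, ∑ sa : S × A, r h sa * occ M π h sa) := by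
  refine ⟨∑ h ∈ Finset.range M.H, 1, ?_⟩
  rintro _ ⟨π, rfl⟩
  refine Finset.sum_le_sum fun h _ => ?_
  rw [← sum_occ M π h]
  exact Finset.sum_le_sum fun sa _ =>
    mul_le_of_le_one_left (occ_nonneg M π h sa) (abs_le.mp (hr h sa)).2

theorem neg_sum_mul_le_l1 {r v : S × A → ℝ} (hr : ∀ sa, |r sa| ≤ 1) :
    -∑ sa, r sa * v sa ≤ l1 v := by
  rw [l1, ← Finset.sum_neg_distrib]
  refine Finset.sum_le_sum fun sa _ => (neg_le_abs _).trans ?_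
  rw [abs_mul]
  exact mul_le_of_le_one_left (abs_nonneg _) (hr sa)

end RewardValue

/-- guarantee of the approximate saddle-point optimization via OGD:
if `w^(t)` are the OGD iterates, `π^(t)` is `ε_opt`-optimal for reward `w^(t)`, and `π̄`
has occupancy measure equal to the average of the occupancy measures of the `π^(t)`, then
`∑_h ‖P^π̄_h − q̃_h‖₁ ≤ inf_π ∑_h ‖P^π_h − q̃_h‖₁ + 2H√(2|S||A|/T) + ε_opt`. -/
theorem approximate_minimax
    {S A : Type} [Fintype S] [Fintype A] [Nonempty S] [Nonempty A]
    (M : MDP S A) (q : ℕ → S × A → ℝ)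
    (hq_nonneg : ∀ h < M.H, ∀ sa : S × A, 0 ≤ q h sa)
    (hq_sum : ∀ h < M.H, ∑ sa : S × A, q h sa ≤ 1)
    (εopt : ℝ) (hεopt : 0 ≤ εopt) (T : ℕ) (hT : 1 ≤ T)
    (η : ℝ)
    (hη : η = Real.sqrt (2 * (Fintype.card S : ℝ) * (Fintype.card A : ℝ) / (T : ℝ)))
    (πt : ℕ → Policy S A) (w : ℕ → ℕ → S × A → ℝ)
    (hw : w = ogd η (fun t h sa => occ M (πt t) h sa - q h sa))
    (hopt : ∀ t < T,
      (∑ h ∈ Finset.range M.H, ∑ sa : S × A, w t h sa * occ M (πt t) h sa)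
        ≥ (⨆ π' : Policy S A,
            ∑ h ∈ Finset.range M.H, ∑ sa : S × A, w t h sa * occ M π' h sa) - εopt)
    (πbar : Policy S A)
    (hbar : ∀ h < M.H, ∀ sa : S × A,
      occ M πbar h sa = (1 / (T : ℝ)) * ∑ t ∈ Finset.range T, occ M (πt t) h sa) :
    (∑ h ∈ Finset.range M.H, l1 (fun sa => occ M πbar h sa - q h sa))
      ≤ (⨅ π' : Policy S A, ∑ h ∈ Finset.range M.H, l1 (fun sa => occ M π' h sa - q h sa))
        + 2 * (M.H : ℝ) *
            Real.sqrt (2 * (Fintype.card S : ℝ) * (Fintype.card A : ℝ) / (T : ℝ))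
        + εopt := by
  have hd : (1 : ℝ) ≤ (Fintype.card S : ℝ) * (Fintype.card A : ℝ) := by
    exact_mod_cast Nat.mul_pos Fintype.card_pos Fintype.card_pos
  have hT0 : (0 : ℝ) < T := by exact_mod_cast hT
  have hη0 : 0 < η := by
    rw [hη]
    refine Real.sqrt_pos.mpr (div_pos ?_ hT0)
    linarith
  have hηsq : η ^ 2 * T = 2 * ((Fintype.card S : ℝ) * (Fintype.card A : ℝ)) := by
    rw [hη, Real.sq_sqrt (by positivity)]
    field_simp
  rw [← hη]
  set g : ℕ → ℕ → S × A → ℝ := fun t h sa => occ M (πt t) h sa - q h sa with hg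
  have hwabs : ∀ t h sa, |w t h sa| ≤ 1 := fun t h sa => hw ▸ abs_ogd_le_one η g t h sa
  have avg : ∀ h < M.H, ∀ sa,
      ∑ t ∈ Finset.range T, g t h sa = T * (occ M πbar h sa - q h sa) := fun h hh sa => by
    rw [hbar h hh sa, hg]
    simp only [Finset.sum_sub_distrib, Finset.sum_const, Finset.card_range, nsmul_eq_mul]
    field_simp
  have coord : ∀ h < M.H, ∀ sa,
      2 * η * (∑ t ∈ Finset.range T, w t h sa * g t h sa
        + T * |occ M πbar h sa - q h sa|)
      ≤ 1 + η ^ 2 * ∑ t ∈ Finset.range T, g t h sa ^ 2 := fun h hh sa => by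
    obtain ⟨u, hu, hmul⟩ : ∃ u : ℝ, |u| ≤ 1 ∧
        (occ M πbar h sa - q h sa) * u = -|occ M πbar h sa - q h sa| := by
      rcases le_total 0 (occ M πbar h sa - q h sa) with hs | hs
      · exact ⟨-1, by simp, by rw [abs_of_nonneg hs]; ring⟩
      · exact ⟨1, by simp, by rw [abs_of_nonpos hs]; ring⟩
    refine le_of_eq_of_le ?_ (ogd_regret_le η g h sa hu T)
    rw [← hw]
    simp only [mul_sub, Finset.sum_sub_distrib]
    rw [← Finset.sum_mul, avg h hh sa, mul_assoc (T : ℝ), hmul]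
    simp only [mul_comm (w _ h sa)]
    ring
  have layer : ∀ h < M.H,
      2 * η * (∑ t ∈ Finset.range T, ∑ sa, w t h sa * g t h sa
        + T * l1 (fun sa => occ M πbar h sa - q h sa))
      ≤ 5 / 2 * (η ^ 2 * T) := fun h hh => by
    have hsum := Finset.sum_le_sum fun sa (_ : sa ∈ Finset.univ) => coord h hh sa
    rw [← Finset.mul_sum, Finset.sum_add_distrib, Finset.sum_add_distrib, ← Finset.mul_sum,
      ← Finset.mul_sum, Finset.sum_comm, Finset.sum_comm (f := fun sa t => g t h sa ^ 2)] at hsum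
    have hsq : ∑ t ∈ Finset.range T, ∑ sa, g t h sa ^ 2 ≤ ∑ t ∈ Finset.range T, (2 : ℝ) :=
      Finset.sum_le_sum fun t _ =>
        sum_sq_occ_sub_le_two M (πt t) h (q h) (hq_nonneg h hh) (hq_sum h hh)
    have hmul := mul_le_mul_of_nonneg_left hsq (sq_nonneg η)
    simp only [Finset.sum_const, Finset.card_range, nsmul_eq_mul, Finset.card_univ,
      Fintype.card_prod, Nat.cast_mul, mul_one] at hsum hmul
    rw [l1]
    linarith
  have regret :
      ∑ t ∈ Finset.range T, ∑ h ∈ Finset.range M.H, ∑ sa, w t h sa * g t h sa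
        + T * ∑ h ∈ Finset.range M.H, l1 (fun sa => occ M πbar h sa - q h sa)
      ≤ T * (5 / 4 * (M.H * η)) := by
    have hsum := Finset.sum_le_sum fun h (hh : h ∈ Finset.range M.H) =>
      layer h (Finset.mem_range.mp hh)
    rw [← Finset.mul_sum, Finset.sum_add_distrib, ← Finset.mul_sum, Finset.sum_comm] at hsum
    simp only [Finset.sum_const, Finset.card_range, nsmul_eq_mul] at hsum
    refine le_of_mul_le_mul_left (hsum.trans_eq ?_) (by positivity : 0 < 2 * η)
    ring
  have : Nonempty (Policy S A) := ⟨πbar⟩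
  rw [add_assoc, ← sub_le_iff_le_add]
  refine le_ciInf fun π => ?_
  have best_response : ∀ t ∈ Finset.range T,
      -(∑ h ∈ Finset.range M.H, l1 (fun sa => occ M π h sa - q h sa)) - εopt
        ≤ ∑ h ∈ Finset.range M.H, ∑ sa, w t h sa * g t h sa := fun t ht => by
    have hsup := le_ciSup (bddAbove_range_sum_mul_occ M (w t) (hwabs t)) π
    have hnear := hopt t (Finset.mem_range.mp ht)
    have hdual := Finset.sum_le_sum fun h (_ : h ∈ Finset.range M.H) =>
      neg_sum_mul_le_l1 (v := fun sa => occ M π h sa - q h sa) (hwabs t h)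
    simp only [hg, mul_sub, Finset.sum_sub_distrib, Finset.sum_neg_distrib] at hdual hsup ⊢
    linarith
  have hsum := Finset.sum_le_sum best_response
  rw [Finset.sum_const, Finset.card_range, nsmul_eq_mul] at hsum
  have hHη : 0 ≤ M.H * η := by positivity
  have hcancel : (T : ℝ) * ∑ h ∈ Finset.range M.H, l1 (fun sa => occ M πbar h sa - q h sa)
      ≤ T * (∑ h ∈ Finset.range M.H, l1 (fun sa => occ M π h sa - q h sa)
        + εopt + 5 / 4 * (M.H * η)) := by
    linarith
  have := le_of_mul_le_mul_left hcancel hT0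
  linarith
end

section
/- Fix an episodic MDP, two policies π^E and π̄, a vector q̃ = (q̃_h)_{h=1}^H in ℝ^{S×A}, and ε₁, ε₂ ≥ 0. Suppose (i) ∑_{h=1}^H ‖P^{π^E}_h − q̃_h‖₁ ≤ ε₁ and (ii) ∑_{h=1}^H ‖P^{π̄}_h − q̃_h‖₁ ≤ inf_{π} ∑_{h=1}^H ‖P^{π}_h − q̃_h‖₁ + ε₂, where the infimum is over all policies. Then for every reward function r = (r_h) with 0 ≤ r_h(s,a) ≤ 1 for all h,s,a, one has |V^{π^E,r} − V^{π̄,r}| ≤ 2ε₁ + ε₂. -/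
open Finset
open scoped Classical

/-- The `ℓ₁` norm is nonnegative. -/
theorem l1_nonneg {S A : Type} [Fintype S] [Fintype A] (v : S × A → ℝ) : 0 ≤ l1 v :=
  Finset.sum_nonneg fun _ _ => abs_nonneg _

/-- Triangle inequality for the `ℓ₁` distance, through an intermediate point `w`. -/
theorem l1_sub_le_add {S A : Type} [Fintype S] [Fintype A] (u v w : S × A → ℝ) :
    l1 (fun sa => u sa - v sa) ≤ l1 (fun sa => u sa - w sa) + l1 (fun sa => v sa - w sa) := by
  unfold l1
  rw [← Finset.sum_add_distrib]
  refine Finset.sum_le_sum fun sa _ => ?_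
  rw [abs_sub_comm (v sa)]
  exact abs_sub_le _ _ _

/-- For rewards bounded by one in absolute value, the value gap of two policies is at most the
total `ℓ₁` distance of their occupancy measures. -/
theorem abs_value_sub_le_sum_l1 {S A : Type} [Fintype S] [Fintype A]
    (M : MDP S A) (π π' : Policy S A) (r : ℕ → S × A → ℝ)
    (hr : ∀ h < M.H, ∀ sa : S × A, |r h sa| ≤ 1) :
    |value M π r - value M π' r| ≤
      ∑ h ∈ Finset.range M.H, l1 (fun sa => occ M π h sa - occ M π' h sa) := by
  unfold value l1
  rw [← Finset.sum_sub_distrib]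
  refine (Finset.abs_sum_le_sum_abs _ _).trans (Finset.sum_le_sum fun h hh => ?_)
  rw [← Finset.sum_sub_distrib]
  refine (Finset.abs_sum_le_sum_abs _ _).trans (Finset.sum_le_sum fun sa _ => ?_)
  rw [← sub_mul, abs_mul]
  exact mul_le_of_le_one_right (abs_nonneg _) (hr h (Finset.mem_range.mp hh) sa)

/-- if `∑_h ‖P^{π^E}_h − q̃_h‖₁ ≤ ε₁` and `π̄` is an `ε₂`-approximate
minimizer of `π ↦ ∑_h ‖P^π_h − q̃_h‖₁` over all policies, then for every reward function
`r` with values in `[0,1]`, `|V^{π^E,r} − V^{π̄,r}| ≤ 2ε₁ + ε₂`. -/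
theorem value_gap_of_l1_projection
    {S A : Type} [Fintype S] [Fintype A] [Nonempty S] [Nonempty A]
    (M : MDP S A) (πE πbar : Policy S A) (q : ℕ → S × A → ℝ)
    (ε₁ ε₂ : ℝ) (hε₁ : 0 ≤ ε₁) (hε₂ : 0 ≤ ε₂)
    (h1 : ∑ h ∈ Finset.range M.H, l1 (fun sa => occ M πE h sa - q h sa) ≤ ε₁)
    (h2 : (∑ h ∈ Finset.range M.H, l1 (fun sa => occ M πbar h sa - q h sa))
      ≤ (⨅ π' : Policy S A,
          ∑ h ∈ Finset.range M.H, l1 (fun sa => occ M π' h sa - q h sa)) + ε₂) :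
    ∀ r : ℕ → S × A → ℝ,
      (∀ h < M.H, ∀ sa : S × A, 0 ≤ r h sa ∧ r h sa ≤ 1) →
      |value M πE r - value M πbar r| ≤ 2 * ε₁ + ε₂ := by
  intro r hr
  have hinf : (⨅ π' : Policy S A,
      ∑ h ∈ Finset.range M.H, l1 (fun sa => occ M π' h sa - q h sa)) ≤
      ∑ h ∈ Finset.range M.H, l1 (fun sa => occ M πE h sa - q h sa) :=
    ciInf_le ⟨0, Set.forall_mem_range.mpr fun _ =>
      Finset.sum_nonneg fun _ _ => l1_nonneg _⟩ πE
  have hgap := abs_value_sub_le_sum_l1 M πE πbar r fun h hh sa =>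
    abs_le.mpr ⟨by linarith [(hr h hh sa).1], (hr h hh sa).2⟩
  have htri := Finset.sum_le_sum fun h (_ : h ∈ Finset.range M.H) =>
    l1_sub_le_add (occ M πE h) (occ M πbar h) (q h)
  rw [Finset.sum_add_distrib] at htri
  linarith
end

section
/- Fix an episodic MDP, an expert policy π^E, a finite set D₁ of length-H trajectories, and a policy π ∈ Π_BC(D₁). Then for every h ∈ {1,…,H} and every (s,a) ∈ S×A, P^{π^E}_h(s,a) = ∑_{tr_h ∈ Tr_h^{D₁}} ℙ^{π}(tr_h) 𝟙{tr_h has (s_h,a_h) = (s,a)} + ∑_{tr_h ∉ Tr_h^{D₁}} ℙ^{π^E}(tr_h) 𝟙{tr_h has (s_h,a_h) = (s,a)}, where both sums range over length-h truncated trajectories in (S×A)^h. -/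
open Finset
open scoped Classical

theorem trajProb_snoc {S A : Type} [Fintype S] [Fintype A] (M : MDP S A) (π : Policy S A)
    (n : ℕ) (tr : Fin (n + 1) → S × A) (q : S × A) :
    trajProb M π (n + 2) (Fin.snoc (α := fun _ => S × A) tr q)
      = trajProb M π (n + 1) tr * M.P n (tr (Fin.last n)).1 (tr (Fin.last n)).2 q.1
          * π.pr (n + 1) q.1 q.2 := by
  have h0 : (Fin.snoc (α := fun _ => S × A) tr q : Fin (n + 2) → S × A) 0 = tr 0 :=
    Fin.snoc_castSucc (α := fun _ => S × A) q tr 0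
  simp only [trajProb]
  rw [Fin.prod_univ_castSucc, h0]
  simp only [Fin.snoc_castSucc, Fin.succ_castSucc, Fin.succ_last, Fin.snoc_last,
    Fin.val_castSucc, Fin.val_last]
  ring

/-- The occupancy measure is the marginal of the trajectory distribution at the last step. -/
theorem occ_eq_sum_trajProb {S A : Type} [Fintype S] [Fintype A] (M : MDP S A)
    (π : Policy S A) (n : ℕ) (sa : S × A) :
    occ M π n sa
      = ∑ tr : Fin (n + 1) → S × A,
          if tr (Fin.last n) = sa then trajProb M π (n + 1) tr else 0 := by
  induction n generalizing sa with
  | zero =>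
    rw [← (Equiv.funUnique (Fin 1) (S × A)).symm.sum_comp]
    simp [occ, trajProb]
  | succ n ih =>
    rw [← (Fin.snocEquiv (fun _ => S × A)).sum_comp, Fintype.sum_prod_type]
    simp only [Fin.snocEquiv_apply, Fin.snoc_last, occ, ih, Finset.sum_mul, ite_mul, zero_mul]
    rw [Finset.sum_comm, Finset.sum_comm (s := (Finset.univ : Finset (S × A)))]
    simp only [Finset.sum_ite_eq, Finset.sum_ite_eq', Finset.mem_univ, if_true]
    exact Finset.sum_congr rfl fun tr _ => (trajProb_snoc M π n tr sa).symm

/-- A policy in `Π_BC(D₁)` has the expert's trajectory probabilities on `Tr^{D₁}`. -/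
theorem trajProb_eq_of_memPiBC {S A : Type} [Fintype S] [Fintype A] {M : MDP S A}
    {πE π : Policy S A} {D₁ : Finset (Fin M.H → S × A)} (hπ : memPiBC M πE π D₁)
    {n : ℕ} {tr : Fin (n + 1) → S × A} (htr : TrMem D₁ tr) :
    trajProb M π (n + 1) tr = trajProb M πE (n + 1) tr := by
  simp only [trajProb]
  congr 1
  · rw [hπ 0 _ (htr 0)]
  · refine Finset.prod_congr rfl fun ℓ _ => ?_
    rw [hπ (ℓ + 1) _ (htr ℓ.succ)]

/-- decomposition of the expert occupancy measure: if `π ∈ Π_BC(D₁)`,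
then for every step `h ∈ {1,…,H}` (here `h = n+1 ≤ H` with 0-indexed `n`) and every
`(s,a)`, `P^{π^E}_h(s,a)` equals the sum of `ℙ^π` over trajectories in `Tr_h^{D₁}` ending
at `(s,a)` plus the sum of `ℙ^{π^E}` over trajectories outside `Tr_h^{D₁}` ending at `(s,a)`. -/
theorem occ_decomposition_PiBC
    {S A : Type} [Fintype S] [Fintype A] [Nonempty S] [Nonempty A]
    (M : MDP S A) (πE : Policy S A) (D₁ : Finset (Fin M.H → S × A))
    (π : Policy S A) (hπ : memPiBC M πE π D₁)
    (n : ℕ) (hn : n + 1 ≤ M.H) (sa : S × A) :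
    occ M πE n sa
      = (∑ tr : Fin (n + 1) → S × A,
          if TrMem D₁ tr ∧ tr (Fin.last n) = sa then trajProb M π (n + 1) tr else 0)
        + ∑ tr : Fin (n + 1) → S × A,
            if ¬ TrMem D₁ tr ∧ tr (Fin.last n) = sa then trajProb M πE (n + 1) tr else 0 := by
  rw [occ_eq_sum_trajProb, ← Finset.sum_add_distrib]
  refine Finset.sum_congr rfl fun tr _ => ?_
  by_cases htr : TrMem D₁ tr
  · simp [htr, trajProb_eq_of_memPiBC hπ htr]
  · simp [htr]
end

section
/- Let S, A, H, ρ be fixed and let P = {P_h} (true) and P̂ = {P̂_h} (estimated) be two transition functions on (S,A,H). Let π^E and π̄ be policies, q̃ = (q̃_h)_{h=1}^H a vector in ℝ^{S×A}, and ε_RFE, ε_EST, ε_AIL ≥ 0. Suppose: (a) for every policy π and every reward function w = (w_h) with |w_h(s,a)| ≤ 1, |V^{π,P,w} − V^{π,P̂,w}| ≤ ε_RFE; (b) ∑_{h=1}^H ‖q̃_h − P^{π^E,P}_h‖₁ ≤ ε_EST; (c) ∑_{h=1}^H ‖q̃_h − P^{π̄,P̂}_h‖₁ ≤ inf_{π}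 ∑_{h=1}^H ‖q̃_h − P^{π,P̂}_h‖₁ + ε_AIL, where the infimum is over all policies. Then for every reward function r = (r_h) with |r_h(s,a)| ≤ 1, the value gap in the true MDP satisfies |V^{π^E,P,r} − V^{π̄,P,r}| ≤ 2ε_EST + 2ε_RFE + ε_AIL. -/
open Finset
open scoped Classical

/-- The `ℓ₁` distance is symmetric. -/
theorem l1_sub_comm {S A : Type} [Fintype S] [Fintype A] (u v : S × A → ℝ) :
    l1 (fun sa => u sa - v sa) = l1 (fun sa => v sa - u sa) := by
  simp only [l1, abs_sub_comm]

/-- Triangle inequality for the `ℓ₁` distance, summed over the timesteps. -/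
theorem sum_l1_sub_le {S A : Type} [Fintype S] [Fintype A] (s : Finset ℕ)
    (u v w : ℕ → S × A → ℝ) :
    ∑ h ∈ s, l1 (fun sa => u h sa - w h sa) ≤
      ∑ h ∈ s, l1 (fun sa => u h sa - v h sa) + ∑ h ∈ s, l1 (fun sa => v h sa - w h sa) := by
  rw [← Finset.sum_add_distrib]
  refine Finset.sum_le_sum fun h _ => ?_
  simp only [l1]
  rw [← Finset.sum_add_distrib]
  exact Finset.sum_le_sum fun sa _ => abs_sub_le _ _ _

/-- The difference of two values is the pairing of the reward with the occupancy difference. -/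
theorem value_sub_value {S A : Type} [Fintype S] [Fintype A] (M M' : MDP S A) (hH : M'.H = M.H)
    (π π' : Policy S A) (r : ℕ → S × A → ℝ) :
    value M π r - value M' π' r =
      ∑ h ∈ Finset.range M.H, ∑ sa : S × A, (occ M π h sa - occ M' π' h sa) * r h sa := by
  simp only [value, hH, sub_mul, Finset.sum_sub_distrib]

/-- For rewards bounded by one, the value gap is at most the `ℓ₁` distance of occupancies. -/
theorem abs_value_sub_value_le {S A : Type} [Fintype S] [Fintype A] (M M' : MDP S A)
    (hH : M'.H = M.H) (π π' : Policy S A) (r : ℕ → S × A → ℝ)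
    (hr : ∀ h < M.H, ∀ sa : S × A, |r h sa| ≤ 1) :
    |value M π r - value M' π' r| ≤
      ∑ h ∈ Finset.range M.H, l1 (fun sa => occ M π h sa - occ M' π' h sa) := by
  rw [value_sub_value M M' hH]
  refine (Finset.abs_sum_le_sum_abs _ _).trans (Finset.sum_le_sum fun h hh => ?_)
  refine (Finset.abs_sum_le_sum_abs _ _).trans (Finset.sum_le_sum fun sa _ => ?_)
  rw [abs_mul]
  exact mul_le_of_le_one_right (abs_nonneg _) (hr h (Finset.mem_range.mp hh) sa)

/-- The `ℓ₁` distance of occupancies is the value gap for the reward given by the sign of the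
occupancy difference. -/
theorem exists_value_sub_value_eq {S A : Type} [Fintype S] [Fintype A] (M M' : MDP S A)
    (hH : M'.H = M.H) (π π' : Policy S A) :
    ∃ w : ℕ → S × A → ℝ, (∀ h sa, |w h sa| ≤ 1) ∧
      value M π w - value M' π' w =
        ∑ h ∈ Finset.range M.H, l1 (fun sa => occ M π h sa - occ M' π' h sa) := by
  refine ⟨fun h sa => (SignType.sign (occ M π h sa - occ M' π' h sa) : ℝ), fun h sa => ?_, ?_⟩
  · dsimp only
    cases SignType.sign (occ M π h sa - occ M' π' h sa) <;> simp
  · rw [value_sub_value M M' hH]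
    simp only [self_mul_sign, l1]

/-- Proposition: connection between reward-free exploration, estimation,
and adversarial imitation: under (a) uniform value accuracy `ε_RFE` of the estimated
transitions `P̂` (in `M'`) against the true transitions `P` (in `M`), (b) estimation error
`ε_EST` of `q̃` against the expert occupancy, and (c) `ε_AIL`-approximate minimization of
the `ℓ₁` projection objective under `P̂` by `π̄`, the value gap in the true MDP satisfies
`|V^{π^E,P,r} − V^{π̄,P,r}| ≤ 2ε_EST + 2ε_RFE + ε_AIL` for every reward `r` with
`|r_h(s,a)| ≤ 1`. -/
theorem connection_rfe_est_ail
    {S A : Type} [Fintype S] [Fintype A] [Nonempty S] [Nonempty A]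
    (M M' : MDP S A) (hH : M'.H = M.H) (hρ : M'.ρ = M.ρ)
    (πE πbar : Policy S A) (q : ℕ → S × A → ℝ)
    (εRFE εEST εAIL : ℝ) (hεRFE : 0 ≤ εRFE) (hεEST : 0 ≤ εEST) (hεAIL : 0 ≤ εAIL)
    (ha : ∀ (π : Policy S A) (w : ℕ → S × A → ℝ),
      (∀ h < M.H, ∀ sa : S × A, |w h sa| ≤ 1) →
      |value M π w - value M' π w| ≤ εRFE)
    (hb : ∑ h ∈ Finset.range M.H, l1 (fun sa => q h sa - occ M πE h sa) ≤ εEST)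
    (hc : (∑ h ∈ Finset.range M.H, l1 (fun sa => q h sa - occ M' πbar h sa))
      ≤ (⨅ π' : Policy S A,
          ∑ h ∈ Finset.range M.H, l1 (fun sa => q h sa - occ M' π' h sa)) + εAIL) :
    ∀ r : ℕ → S × A → ℝ,
      (∀ h < M.H, ∀ sa : S × A, |r h sa| ≤ 1) →
      |value M πE r - value M πbar r| ≤ 2 * εEST + 2 * εRFE + εAIL := by
  intro r hr
  obtain ⟨w, hw, hw_eq⟩ := exists_value_sub_value_eq M M' hH πE πE
  have h_dual : ∑ h ∈ Finset.range M.H, l1 (fun sa => occ M πE h sa - occ M' πE h sa) ≤ εRFE :=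
    hw_eq ▸ (le_abs_self _).trans (ha πE w fun h _ => hw h)
  have h_inf : (⨅ π' : Policy S A,
      ∑ h ∈ Finset.range M.H, l1 (fun sa => q h sa - occ M' π' h sa)) ≤
      ∑ h ∈ Finset.range M.H, l1 (fun sa => q h sa - occ M' πE h sa) := by
    refine ciInf_le ⟨0, ?_⟩ πE
    rintro _ ⟨π', rfl⟩
    exact Finset.sum_nonneg fun h _ => Finset.sum_nonneg fun sa _ => abs_nonneg _
  have h_comm : ∑ h ∈ Finset.range M.H, l1 (fun sa => occ M πE h sa - q h sa) =
      ∑ h ∈ Finset.range M.H, l1 (fun sa => q h sa - occ M πE h sa) :=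
    Finset.sum_congr rfl fun h _ => l1_sub_comm _ _
  have h_proj := sum_l1_sub_le (Finset.range M.H) q (occ M πE) (occ M' πE)
  have h_tri := sum_l1_sub_le (Finset.range M.H) (occ M πE) q (occ M' πbar)
  have h_gap := abs_value_sub_value_le M M' hH πE πbar r hr
  have h_split := abs_sub_le (value M πE r) (value M' πbar r) (value M πbar r)
  have h_rfe := ha πbar r hr
  rw [abs_sub_comm] at h_rfe
  linarith
end
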